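/- Let n be a positive integer and suppose f is a transcendental entire function on ℂ with ρ(f) < 1 solving the differential-difference equation f(z)^n + w·f(z)^{n-1}·f'(z) + q(z)e^{Q(z)}·f(z+c) = p₁e^{α₁z} + p₂e^{α₂z}, where w, c, p₁, p₂, α₁, α₂ are nonzero complex constants with α₁ ≠ α₂, q is a nonzero polynomial, and Q is a nonconstant polynomial. Then deg Q = 1. -/

import Mathlib

open MeasureTheory Filter Metric

noncomputable section

/-- The positive part `log⁺` of the logarithm. -/
def logPlus (x : ℝ) : ℝ := max (Real.log x) 0

/-- The Nevanlinna proximity function `m(r,f)`.  For an entire function `f` (which has no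
poles) this coincides with the Nevanlinna characteristic `T(r,f)`. -/
def nevCharEntire (f : ℂ → ℂ) (r : ℝ) : ℝ :=
  (2 * Real.pi)⁻¹ * ∫ θ in (0:ℝ)..(2 * Real.pi), logPlus ‖f (r * Complex.exp (θ * Complex.I))‖

/-- The order of growth `ρ(f) = limsup_{r→∞} log⁺ T(r,f) / log r` of an entire function,
as an extended real number. -/
def growthOrderEntire (f : ℂ → ℂ) : EReal :=
  Filter.limsup (fun r : ℝ => ((logPlus (nevCharEntire f r) / Real.log r : ℝ) : EReal))
    Filter.atTop

/-- An entire function is transcendental if it is not a polynomial. -/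
def TranscendentalEntire (f : ℂ → ℂ) : Prop := ¬ ∃ p : Polynomial ℂ, ∀ z, f z = p.eval z

section GrowthBounds

open Real

/-- Polar coordinates around `a`, with the angular integral written as a circle average. -/
lemma setIntegral_ball_eq_integral_circleAverage {φ : ℂ → ℝ} (hφ : Continuous φ) (a : ℂ) {r : ℝ}
    (hr : 0 ≤ r) :
    ∫ z in ball a r, φ z = ∫ s in (0 : ℝ)..r, 2 * π * (s * circleAverage φ a s) := by
  have h_shift : ∫ z in ball a r, φ z = ∫ z, (ball (0 : ℂ) r).indicator (fun z => φ (z + a)) z := by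
    rw [← integral_indicator measurableSet_ball, ← integral_add_right_eq_self _ a]
    congr 1 with z
    simp [Set.indicator, mem_ball, dist_eq_norm]
  have h_indicator : ∀ p ∈ polarCoord.target,
      p.1 • (ball (0 : ℂ) r).indicator (fun z => φ (z + a)) (Complex.polarCoord.symm p) =
        (Set.Ioo 0 r ×ˢ Set.Ioo (-π) π).indicator
          (fun p : ℝ × ℝ => p.1 * φ (circleMap a p.1 p.2)) p := by
    rintro ⟨s, θ⟩ hp
    obtain ⟨hs, hθ⟩ : 0 < s ∧ θ ∈ Set.Ioo (-π) π := by simpa [polarCoord_target] using hp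
    have h_map : Complex.polarCoord.symm (s, θ) + a = circleMap a s θ := by
      rw [Complex.polarCoord_symm_apply, circleMap, Complex.exp_mul_I, add_comm]
      push_cast
      rfl
    by_cases hsr : s < r
    · rw [Set.indicator_of_mem, Set.indicator_of_mem, h_map, smul_eq_mul]
      · exact ⟨⟨hs, hsr⟩, hθ⟩
      · rw [mem_ball_zero_iff, Complex.norm_polarCoord_symm, abs_of_pos hs]
        exact hsr
    · rw [Set.indicator_of_notMem, Set.indicator_of_notMem, smul_zero]
      · exact fun h => hsr h.1.2
      · rw [mem_ball_zero_iff, Complex.norm_polarCoord_symm, abs_of_pos hs]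
        exact hsr
  have h_cont : Continuous fun p : ℝ × ℝ => p.1 * φ (circleMap a p.1 p.2) := by
    unfold circleMap
    fun_prop
  have h_angle (s : ℝ) :
      ∫ θ in Set.Ioo (-π) π, s * φ (circleMap a s θ) = 2 * π * (s * circleAverage φ a s) := by
    have h_per : (fun θ => φ (circleMap a s θ)).Periodic (2 * π) :=
      fun θ => by simp [periodic_circleMap a s θ]
    have h_eq := h_per.intervalIntegral_add_eq 0 (-π)
    rw [show -π + 2 * π = π by ring, zero_add] at h_eq
    rw [integral_const_mul, ← integral_Ioc_eq_integral_Ioo,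
      ← intervalIntegral.integral_of_le (by linarith [pi_pos]), ← h_eq, circleAverage_def,
      smul_eq_mul]
    field_simp
  have h_meas : MeasurableSet (Set.Ioo 0 r ×ˢ Set.Ioo (-π) π : Set (ℝ × ℝ)) :=
    measurableSet_Ioo.prod measurableSet_Ioo
  have h_sub : (Set.Ioo 0 r ×ˢ Set.Ioo (-π) π : Set (ℝ × ℝ)) ⊆ polarCoord.target :=
    Set.prod_mono Set.Ioo_subset_Ioi_self subset_rfl
  rw [h_shift, ← Complex.integral_comp_polarCoord_symm,
    setIntegral_congr_fun polarCoord.open_target.measurableSet h_indicator,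
    setIntegral_indicator h_meas, Set.inter_eq_self_of_subset_right h_sub, Measure.volume_eq_prod,
    setIntegral_prod, intervalIntegral.integral_of_le hr, integral_Ioc_eq_integral_Ioo]
  · simp only [h_angle]
  · exact (h_cont.continuousOn.integrableOn_compact
      (isCompact_Icc.prod isCompact_Icc)).mono_set
        (Set.prod_mono Set.Ioo_subset_Icc_self Set.Ioo_subset_Icc_self)

/-- The function `log ‖f‖` is subharmonic for entire `f`. -/
lemma log_norm_le_circleAverage_log_norm {f : ℂ → ℂ} (hf : Differentiable ℂ f) {a : ℂ}
    (ha : f a ≠ 0) {R : ℝ} (hR : 0 < R) :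
    log ‖f a‖ ≤ circleAverage (fun z => log ‖f z‖) a R := by
  have h_an : AnalyticOnNhd ℂ f (closedBall a |R|) := fun z _ => hf.analyticAt z
  rw [h_an.circleAverage_log_norm hR.ne' ha]
  refine le_add_of_nonneg_left (finsum_nonneg fun u => ?_)
  by_cases hu : u ∈ closedBall a |R|
  · refine mul_nonneg ?_ ?_
    · exact_mod_cast MeromorphicOn.AnalyticOnNhd.divisor_nonneg h_an u
    · rw [mem_closedBall, dist_comm, dist_eq_norm, abs_of_pos hR] at hu
      rcases eq_or_ne u a with rfl | hne
      · simp
      · have : 0 < ‖a - u‖ := norm_pos_iff.2 (sub_ne_zero.2 hne.symm)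
        exact log_nonneg ((le_mul_inv_iff₀ this).2 (by rwa [one_mul]))
  · rw [Function.locallyFinsuppWithin.apply_eq_zero_of_notMem _ hu]
    simp

/-- The function `log⁺ ‖f‖` is subharmonic for entire `f`. -/
lemma posLog_norm_le_circleAverage_posLog_norm {f : ℂ → ℂ} (hf : Differentiable ℂ f) (a : ℂ)
    {R : ℝ} (hR : 0 < R) :
    log⁺ ‖f a‖ ≤ circleAverage (fun z => log⁺ ‖f z‖) a R := by
  by_cases ha : 1 ≤ ‖f a‖
  · rw [posLog_eq_log (by simpa using ha)]
    refine (log_norm_le_circleAverage_log_norm hf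
      (norm_pos_iff.1 (one_pos.trans_le ha)) hR).trans ?_
    have h_mer : MeromorphicOn f (sphere a |R|) := fun z _ => (hf.analyticAt z).meromorphicAt
    exact circleAverage_mono h_mer.circleIntegrable_log_norm h_mer.circleIntegrable_posLog_norm
      fun z _ => le_max_right _ _
  · rw [(posLog_eq_zero_iff _).2 (by simpa using (not_le.1 ha).le)]
    exact circleAverage_nonneg_of_nonneg fun z _ => posLog_nonneg

/-- The area form of the mean value inequality bounds `log⁺ ‖f‖` pointwise through its averages
over circles centred at the origin. -/
lemma posLog_norm_le_of_circleAverage_le {f : ℂ → ℂ} (hf : Differentiable ℂ f) {K : ℝ}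
    (hK : ∀ s, 0 ≤ s → circleAverage (fun z => log⁺ ‖f z‖) 0 s ≤ K + s) {r : ℝ} (hr : 0 < r)
    {a : ℂ} (ha : ‖a‖ ≤ r) :
    log⁺ ‖f a‖ ≤ 4 * (K + 2 * r) := by
  set φ : ℂ → ℝ := fun z => log⁺ ‖f z‖ with hφ_def
  have hφ : Continuous φ := continuous_posLog.comp hf.continuous.norm
  have h_int (b : ℂ) (B : ℝ) :
      IntervalIntegrable (fun s => 2 * π * (s * circleAverage φ b s)) volume 0 B :=
    (continuous_const.mul (continuous_id.mul hφ.circleAverage)).intervalIntegrable _ _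
  have h_lower : π * r ^ 2 * φ a ≤ ∫ z in ball a r, φ z := by
    rw [setIntegral_ball_eq_integral_circleAverage hφ a hr.le]
    calc π * r ^ 2 * φ a = ∫ s in (0 : ℝ)..r, 2 * π * φ a * s := by
          rw [intervalIntegral.integral_const_mul, integral_id]
          ring
      _ ≤ _ := by
          refine intervalIntegral.integral_mono_on_of_le_Ioo hr.le
            ((by fun_prop : Continuous _).intervalIntegrable _ _) (h_int a r) fun s hs => ?_
          have := mul_le_mul_of_nonneg_left (posLog_norm_le_circleAverage_posLog_norm hf a hs.1)
            (by have := hs.1; positivity : 0 ≤ 2 * π * s)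
          calc 2 * π * φ a * s = 2 * π * s * φ a := by ring
            _ ≤ _ := this
            _ = _ := by ring
  have h_mono : ∫ z in ball a r, φ z ≤ ∫ z in ball 0 (2 * r), φ z := by
    refine setIntegral_mono_set ?_ (Eventually.of_forall fun z => posLog_nonneg)
      (LE.le.eventuallyLE (ball_subset_ball' ?_))
    · exact (hφ.continuousOn.integrableOn_compact (isCompact_closedBall 0 (2 * r))).mono_set
        ball_subset_closedBall
    · rw [dist_zero_right]
      linarith
  have h_upper : ∫ z in ball 0 (2 * r), φ z ≤ 4 * π * r ^ 2 * (K + 2 * r) := by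
    rw [setIntegral_ball_eq_integral_circleAverage hφ 0 (by positivity)]
    calc _ ≤ ∫ s in (0 : ℝ)..(2 * r), 2 * π * (K + 2 * r) * s := by
          refine intervalIntegral.integral_mono_on_of_le_Ioo (by positivity) (h_int 0 _)
            ((by fun_prop : Continuous _).intervalIntegrable _ _) fun s hs => ?_
          have h_avg : circleAverage φ 0 s ≤ K + 2 * r := by linarith [hK s hs.1.le, hs.2]
          have := mul_le_mul_of_nonneg_left h_avg (by have := hs.1; positivity : 0 ≤ 2 * π * s)
          linarith
      _ = _ := by
          rw [intervalIntegral.integral_const_mul, integral_id]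
          ring
  refine le_of_mul_le_mul_left (a := π * r ^ 2) ?_ (by positivity)
  linarith

lemma nevCharEntire_eq_circleAverage (f : ℂ → ℂ) (r : ℝ) :
    nevCharEntire f r = circleAverage (fun z => log⁺ ‖f z‖) 0 r := by
  simp [nevCharEntire, logPlus, circleAverage_def, circleMap, posLog_apply, max_comm]

/-- An entire function of order less than one has characteristic at most `K + r`. -/
lemma exists_circleAverage_posLog_norm_le {f : ℂ → ℂ} (hf : Differentiable ℂ f)
    (hord : growthOrderEntire f < (1 : EReal)) :
    ∃ K, ∀ s, 0 ≤ s → circleAverage (fun z => log⁺ ‖f z‖) 0 s ≤ K + s := by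
  have h_large : ∀ᶠ r in atTop, nevCharEntire f r ≤ r := by
    filter_upwards [eventually_lt_of_limsup_lt hord, eventually_gt_atTop 1] with r hr hr₁
    have h_lt : logPlus (nevCharEntire f r) / log r < 1 := by exact_mod_cast hr
    rw [div_lt_one (log_pos hr₁)] at h_lt
    by_contra! h
    exact absurd ((le_max_left _ _).trans_lt h_lt) (log_lt_log (one_pos.trans hr₁) h).not_gt
  obtain ⟨S, hS⟩ := eventually_atTop.1 h_large
  have h_cont : Continuous fun s => circleAverage (fun z => log⁺ ‖f z‖) 0 s :=
    (continuous_posLog.comp hf.continuous.norm).circleAverage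
  obtain ⟨K, hK⟩ := (isCompact_Icc (a := 0) (b := S)).bddAbove_image h_cont.continuousOn
  refine ⟨max K 0, fun s hs => ?_⟩
  rcases le_total s S with h | h
  · linarith [hK (Set.mem_image_of_mem _ (⟨hs, h⟩ : s ∈ Set.Icc 0 S)), le_max_left K 0]
  · have := hS s h
    rw [nevCharEntire_eq_circleAverage] at this
    linarith [le_max_right K 0]

/-- Functions of at most exponential growth. -/
def HasExpGrowth (F : ℂ → ℂ) : Prop := ∃ C, 0 ≤ C ∧ ∀ z, ‖F z‖ ≤ exp (C * (1 + ‖z‖))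

namespace HasExpGrowth

variable {F G : ℂ → ℂ}

lemma of_growthOrderEntire_lt_one (hF : Differentiable ℂ F)
    (hord : growthOrderEntire F < (1 : EReal)) : HasExpGrowth F := by
  obtain ⟨K, hK⟩ := exists_circleAverage_posLog_norm_le hF hord
  refine ⟨4 * (|K| + 2), by positivity, fun z => ?_⟩
  have h_bound := posLog_norm_le_of_circleAverage_le hF hK (a := z) (r := 1 + ‖z‖)
    (by positivity) (by linarith)
  rcases eq_or_ne (F z) 0 with h | h
  · rw [h, norm_zero]
    positivity
  · rw [← log_le_iff_le_exp (norm_pos_iff.2 h)]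
    have := (le_max_right 0 (log ‖F z‖)).trans h_bound
    nlinarith [le_abs_self K, abs_nonneg K, norm_nonneg z,
      mul_nonneg (abs_nonneg K) (norm_nonneg z)]

lemma const (k : ℂ) : HasExpGrowth fun _ => k := by
  refine ⟨‖k‖, norm_nonneg k, fun z => ?_⟩
  nlinarith [add_one_le_exp (‖k‖ * (1 + ‖z‖)), mul_nonneg (norm_nonneg k) (norm_nonneg z)]

lemma id : HasExpGrowth fun z => z :=
  ⟨1, zero_le_one, fun z => by linarith [add_one_le_exp (1 * (1 + ‖z‖))]⟩

lemma add (hF : HasExpGrowth F) (hG : HasExpGrowth G) : HasExpGrowth fun z => F z + G z := by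
  obtain ⟨A, hA₀, hA⟩ := hF
  obtain ⟨B, hB₀, hB⟩ := hG
  refine ⟨A + B + 1, by positivity, fun z => ?_⟩
  have hz := norm_nonneg z
  calc ‖F z + G z‖ ≤ exp (A * (1 + ‖z‖)) + exp (B * (1 + ‖z‖)) :=
        (norm_add_le _ _).trans (add_le_add (hA z) (hB z))
    _ ≤ exp ((A + B) * (1 + ‖z‖)) + exp ((A + B) * (1 + ‖z‖)) := by
        gcongr <;> linarith
    _ = 2 * exp ((A + B) * (1 + ‖z‖)) := by ring
    _ ≤ exp 1 * exp ((A + B) * (1 + ‖z‖)) := by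
        gcongr
        linarith [add_one_le_exp 1]
    _ ≤ exp ((A + B + 1) * (1 + ‖z‖)) := by
        rw [← exp_add]
        gcongr
        linarith

lemma mul (hF : HasExpGrowth F) (hG : HasExpGrowth G) : HasExpGrowth fun z => F z * G z := by
  obtain ⟨A, hA₀, hA⟩ := hF
  obtain ⟨B, hB₀, hB⟩ := hG
  refine ⟨A + B, by positivity, fun z => ?_⟩
  rw [norm_mul, add_mul, exp_add]
  gcongr
  exacts [hA z, hB z]

lemma pow (hF : HasExpGrowth F) (n : ℕ) : HasExpGrowth fun z => F z ^ n := by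
  induction n with
  | zero => simpa using const 1
  | succ n ih => simpa only [pow_succ] using ih.mul hF

lemma sub (hF : HasExpGrowth F) (hG : HasExpGrowth G) : HasExpGrowth fun z => F z - G z := by
  simpa [sub_eq_add_neg] using hF.add ((const (-1)).mul hG)

lemma comp_add_const (hF : HasExpGrowth F) (c : ℂ) : HasExpGrowth fun z => F (z + c) := by
  obtain ⟨A, hA₀, hA⟩ := hF
  refine ⟨A * (1 + ‖c‖), by positivity, fun z => (hA _).trans (exp_le_exp.2 ?_)⟩
  rw [mul_assoc]
  gcongr
  nlinarith [norm_add_le z c, mul_nonneg (norm_nonneg z) (norm_nonneg c)]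

lemma deriv (hF : HasExpGrowth F) (hd : Differentiable ℂ F) : HasExpGrowth (deriv F) := by
  obtain ⟨A, hA₀, hA⟩ := hF
  refine ⟨2 * A, by positivity, fun z => ?_⟩
  have := Complex.norm_deriv_le_of_forall_mem_sphere_norm_le (c := z) (f := F) one_pos
    hd.diffContOnCl (C := exp (2 * A * (1 + ‖z‖))) fun u hu => ?_
  · simpa using this
  · refine (hA u).trans (exp_le_exp.2 ?_)
    have hu' : ‖u‖ ≤ ‖z‖ + 1 := by
      rw [mem_sphere_iff_norm] at hu
      linarith [norm_sub_norm_le u z]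
    nlinarith [norm_nonneg z, mul_nonneg hA₀ (norm_nonneg z), mul_le_mul_of_nonneg_left hu' hA₀]

lemma cexp_const_mul (α : ℂ) : HasExpGrowth fun z => Complex.exp (α * z) := by
  refine ⟨‖α‖, norm_nonneg α, fun z => ?_⟩
  rw [Complex.norm_exp, exp_le_exp]
  have := (Complex.re_le_norm (α * z)).trans_eq (norm_mul α z)
  linarith [norm_nonneg α]

lemma polynomial (q : Polynomial ℂ) : HasExpGrowth fun z => q.eval z := by
  induction q using Polynomial.induction_on' with
  | add p q hp hq => simpa using hp.add hq
  | monomial n a => simpa using (const a).mul (id.pow n)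

end HasExpGrowth

lemma integral_circleMap_pow_mul_exp (R : ℝ) (k : ℕ) (m : ℤ) :
    ∫ θ in (0 : ℝ)..2 * π, circleMap 0 R θ ^ k * Complex.exp (-(m * θ * Complex.I)) =
      if (k : ℤ) = m then 2 * π * (R : ℂ) ^ k else 0 := by
  have h_term (θ : ℝ) : circleMap 0 R θ ^ k * Complex.exp (-(m * θ * Complex.I)) =
      R ^ k * Complex.exp (((k - m : ℤ) : ℂ) * Complex.I * θ) := by
    rw [circleMap_zero, mul_pow, ← Complex.exp_nat_mul, mul_assoc, ← Complex.exp_add]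
    push_cast
    ring_nf
  simp only [h_term, intervalIntegral.integral_const_mul]
  split_ifs with hk
  · simp [hk, mul_comm]
  · have h_ne : ((k - m : ℤ) : ℂ) * Complex.I ≠ 0 :=
      mul_ne_zero (Int.cast_ne_zero.2 (sub_ne_zero.2 hk)) Complex.I_ne_zero
    have h_period : Complex.exp (((k - m : ℤ) : ℂ) * Complex.I * ((2 * π : ℝ) : ℂ)) = 1 := by
      rw [← Complex.exp_int_mul_two_pi_mul_I (k - m)]
      congr 1
      push_cast
      ring
    rw [integral_exp_mul_complex h_ne, h_period]
    simp

/-- The Fourier coefficients of a polynomial on a circle. -/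
lemma integral_eval_circleMap_mul_exp (P : Polynomial ℂ) (R : ℝ) (m : ℤ) :
    ∫ θ in (0 : ℝ)..2 * π, P.eval (circleMap 0 R θ) * Complex.exp (-(m * θ * Complex.I)) =
      if 0 ≤ m then 2 * π * (P.coeff m.toNat * (R : ℂ) ^ m.toNat) else 0 := by
  induction P using Polynomial.induction_on' with
  | add p q hp hq =>
    have h_int (p : Polynomial ℂ) : IntervalIntegrable (fun θ : ℝ =>
        p.eval (circleMap 0 R θ) * Complex.exp (-(m * θ * Complex.I))) volume 0 (2 * π) :=
      ((p.continuous.comp (continuous_circleMap 0 R)).mul (by fun_prop)).intervalIntegrable _ _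
    simp only [Polynomial.eval_add, add_mul, Polynomial.coeff_add]
    rw [intervalIntegral.integral_add (h_int p) (h_int q), hp, hq]
    split_ifs <;> ring
  | monomial k a =>
    simp only [Polynomial.eval_monomial, mul_assoc a, intervalIntegral.integral_const_mul]
    rw [integral_circleMap_pow_mul_exp, Polynomial.coeff_monomial]
    rcases le_or_gt 0 m with hm | hm
    · lift m to ℕ using hm
      by_cases hk : k = m
      · simp [hk]
        ring
      · simp [hk]
    · rw [if_neg (by omega), if_neg (by omega), mul_zero]

/-- Each nonconstant coefficient of a polynomial is controlled by the mean of the absolute value of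
its real part on a circle. -/
lemma norm_coeff_mul_pow_le_circleAverage_abs_re (P : Polynomial ℂ) {R : ℝ} (hR : 0 ≤ R) {m : ℕ}
    (hm : m ≠ 0) :
    ‖P.coeff m‖ * R ^ m ≤ 2 * circleAverage (fun z => |(P.eval z).re|) 0 R := by
  have h_cont : Continuous fun θ : ℝ => P.eval (circleMap 0 R θ) :=
    P.continuous.comp (continuous_circleMap 0 R)
  have h_pos := integral_eval_circleMap_mul_exp P R m
  have h_neg : ∫ θ in (0 : ℝ)..2 * π, (starRingEnd ℂ) (P.eval (circleMap 0 R θ)) *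
      Complex.exp (-(m * θ * Complex.I)) = 0 := by
    have h_conj := congrArg (starRingEnd ℂ) (integral_eval_circleMap_mul_exp P R (-m))
    rw [if_neg (by omega), map_zero, intervalIntegral.integral_of_le two_pi_pos.le, ← integral_conj,
      ← intervalIntegral.integral_of_le two_pi_pos.le] at h_conj
    refine Eq.trans ?_ h_conj
    congr 1 with θ
    rw [map_mul, ← Complex.exp_conj]
    simp
  have h_sum : ∫ θ in (0 : ℝ)..2 * π, (2 * (P.eval (circleMap 0 R θ)).re : ℂ) *
      Complex.exp (-(m * θ * Complex.I)) = 2 * π * (P.coeff m * (R : ℂ) ^ m) := by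
    simp only [Nat.cast_nonneg, if_true, Int.toNat_natCast, Int.cast_natCast] at h_pos
    have h_exp : Continuous fun θ : ℝ => Complex.exp (-(m * θ * Complex.I)) := by fun_prop
    have h_add := intervalIntegral.integral_add
      ((h_cont.mul h_exp).intervalIntegrable (μ := volume) 0 (2 * π))
      (((Complex.continuous_conj.comp h_cont).mul h_exp).intervalIntegrable 0 (2 * π))
    simp only [Pi.mul_apply, Function.comp_apply] at h_add
    rw [h_pos, h_neg, add_zero] at h_add
    rw [← h_add]
    congr 1 with θ
    rw [← add_mul, Complex.add_conj]
    push_cast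
    rfl
  have h_le := intervalIntegral.norm_integral_le_integral_norm (μ := volume) two_pi_pos.le
    (f := fun θ : ℝ => (2 * (P.eval (circleMap 0 R θ)).re : ℂ) *
      Complex.exp (-(m * θ * Complex.I)))
  rw [h_sum] at h_le
  have h_norm (θ : ℝ) : ‖(2 * (P.eval (circleMap 0 R θ)).re : ℂ) *
      Complex.exp (-(m * θ * Complex.I))‖ = 2 * |(P.eval (circleMap 0 R θ)).re| := by
    rw [norm_mul, Complex.norm_exp]
    simp
  simp only [h_norm, intervalIntegral.integral_const_mul] at h_le
  rw [circleAverage_def, smul_eq_mul]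
  simp only [norm_mul, norm_pow, Complex.norm_real, Complex.norm_ofNat, norm_eq_abs,
    abs_of_pos pi_pos, abs_of_nonneg hR] at h_le
  refine le_of_mul_le_mul_left (a := 2 * π) (h_le.trans_eq ?_) two_pi_pos
  field_simp

lemma natDegree_le_one_of_circleAverage_abs_re_le {P : Polynomial ℂ} {A B : ℝ}
    (h : ∀ R, 0 < R → circleAverage (fun z => |(P.eval z).re|) 0 R ≤ A + B * R) :
    P.natDegree ≤ 1 := by
  by_contra! h_deg
  have h_lead : 0 < ‖P.coeff P.natDegree‖ := by
    rw [norm_pos_iff, Polynomial.coeff_natDegree, Polynomial.leadingCoeff_ne_zero]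
    rintro rfl
    simp at h_deg
  set a := ‖P.coeff P.natDegree‖
  set R := 1 + 2 * (|A| + |B|) / a with hR_def
  have hR : 1 ≤ R := by
    rw [hR_def]
    linarith [show 0 ≤ 2 * (|A| + |B|) / a by positivity]
  have hR₀ : 0 < R := one_pos.trans_le hR
  have h_aR : a * R = a + 2 * (|A| + |B|) := by
    rw [hR_def]
    field_simp
  have h_coeff := norm_coeff_mul_pow_le_circleAverage_abs_re P hR₀.le (by omega : P.natDegree ≠ 0)
  have h_pow : a * R ^ 2 ≤ a * R ^ P.natDegree :=
    mul_le_mul_of_nonneg_left (pow_le_pow_right₀ hR h_deg) h_lead.le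
  have h_sq : a * R ^ 2 = a * R + 2 * (|A| + |B|) * R := by
    linear_combination R * h_aR
  nlinarith [h R hR₀, le_abs_self A, mul_le_mul_of_nonneg_right (le_abs_self B) hR₀.le,
    mul_le_mul_of_nonneg_left hR (abs_nonneg A), mul_pos h_lead hR₀]

/-- A polynomial exponent relating two nonzero entire functions of at most exponential growth has
degree at most one. -/
lemma natDegree_le_one_of_mul_cexp_eq {g H : ℂ → ℂ} (hg : Differentiable ℂ g)
    (hH : Differentiable ℂ H) (hg_growth : HasExpGrowth g) (hH_growth : HasExpGrowth H)
    {Q : Polynomial ℂ} (h_eq : ∀ z, g z * Complex.exp (Q.eval z) = H z) {a : ℂ} (ha : g a ≠ 0) :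
    Q.natDegree ≤ 1 := by
  obtain ⟨A, hA₀, hA⟩ := hg_growth
  obtain ⟨B, hB₀, hB⟩ := hH_growth
  have hHa : H a ≠ 0 := by
    rw [← h_eq]
    exact mul_ne_zero ha (Complex.exp_ne_zero _)
  have h_log {F : ℂ → ℂ} {C : ℝ} (hC₀ : 0 ≤ C) (hC : ∀ z, ‖F z‖ ≤ exp (C * (1 + ‖z‖))) (z : ℂ) :
      log ‖F z‖ ≤ C * (1 + ‖z‖) := by
    rcases eq_or_ne (F z) 0 with h | h
    · rw [h, norm_zero, log_zero]
      positivity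
    · rw [log_le_iff_le_exp (norm_pos_iff.2 h)]
      exact hC z
  have h_comp : (Q.comp (Polynomial.X + Polynomial.C a)).natDegree = Q.natDegree := by
    rw [Polynomial.natDegree_comp, Polynomial.natDegree_X_add_C, mul_one]
  rw [← h_comp]
  refine natDegree_le_one_of_circleAverage_abs_re_le
    (A := 2 * ((A + B) * (1 + ‖a‖)) - log ‖H a‖ - log ‖g a‖) (B := 2 * (A + B)) fun R hR => ?_
  have h_shift : circleAverage
      (fun z => |((Q.comp (Polynomial.X + Polynomial.C a)).eval z).re|) 0 R =
      circleAverage (fun z => |(Q.eval z).re|) a R := by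
    simpa using circleAverage_map_add_const (f := fun z => |(Q.eval z).re|) (c := a) (R := R)
  set M := (A + B) * (1 + (‖a‖ + R)) with hM
  have h_mer {F : ℂ → ℂ} (hF : Differentiable ℂ F) : MeromorphicOn F (sphere a |R|) :=
    fun z _ => (hF.analyticAt z).meromorphicAt
  have h_nonzero : ∀ᶠ z in codiscreteWithin (sphere a |R|), g z ≠ 0 := by
    have h_an : AnalyticOnNhd ℂ g Set.univ := fun z _ => hg.analyticAt z
    refine (h_an.eqOn_zero_or_eventually_ne_zero_of_preconnected
      isPreconnected_univ).elim (fun h => absurd (h (Set.mem_univ a)) ha)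
      (fun h => codiscreteWithin_mono (Set.subset_univ _) h)
  set k : ℂ → ℝ := fun z => |log ‖H z‖ - log ‖g z‖| with hk
  have h_congr : k =ᶠ[codiscreteWithin (sphere a |R|)] fun z => |(Q.eval z).re| := by
    filter_upwards [h_nonzero] with z hz
    simp only [hk]
    rw [← h_eq, norm_mul,
      log_mul (norm_ne_zero_iff.2 hz) (norm_ne_zero_iff.2 (Complex.exp_ne_zero _)),
      Complex.norm_exp, log_exp, add_sub_cancel_left]
  have h_intH := (h_mer hH).circleIntegrable_log_norm
  have h_intg := (h_mer hg).circleIntegrable_log_norm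
  rw [h_shift, ← circleAverage_congr_codiscreteWithin h_congr hR.ne']
  calc circleAverage k a R
      ≤ circleAverage (fun z => 2 * M - log ‖H z‖ - log ‖g z‖) a R := by
        refine circleAverage_mono (h_intH.sub h_intg).abs
          (((circleIntegrable_const _ _ _).sub h_intH).sub h_intg) fun z hz => ?_
        have h_norm : ‖z‖ ≤ ‖a‖ + R := by
          rw [mem_sphere_iff_norm, abs_of_pos hR] at hz
          linarith [norm_sub_norm_le z a]
        have h_one : 0 ≤ 1 + ‖z‖ := by positivity
        have hgM : log ‖g z‖ ≤ M := (h_log hA₀ hA z).trans (by rw [hM]; gcongr; linarith)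
        have hHM : log ‖H z‖ ≤ M := (h_log hB₀ hB z).trans (by rw [hM]; gcongr; linarith)
        exact abs_le.2 ⟨by linarith, by linarith⟩
    _ = 2 * M - circleAverage (fun z => log ‖H z‖) a R
          - circleAverage (fun z => log ‖g z‖) a R := by
        rw [circleAverage_fun_sub (f₁ := fun z => 2 * M - log ‖H z‖) (f₂ := fun z => log ‖g z‖)
            ((circleIntegrable_const _ _ _).sub h_intH) h_intg,
          circleAverage_fun_sub (f₁ := fun _ => 2 * M) (f₂ := fun z => log ‖H z‖)
            (circleIntegrable_const _ _ _) h_intH, circleAverage_const]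
    _ ≤ 2 * M - log ‖H a‖ - log ‖g a‖ := by
        gcongr
        exacts [log_norm_le_circleAverage_log_norm hH hHa hR,
          log_norm_le_circleAverage_log_norm hg ha hR]
    _ = _ := by
        rw [hM]
        ring

end GrowthBounds

theorem statement11 (n : ℕ) (hn : 1 ≤ n) (c w p₁ p₂ α₁ α₂ : ℂ)
    (hw : w ≠ 0) (hc : c ≠ 0) (hp₁ : p₁ ≠ 0) (hp₂ : p₂ ≠ 0) (hα₁ : α₁ ≠ 0) (hα₂ : α₂ ≠ 0)
    (hα : α₁ ≠ α₂) (q Q : Polynomial ℂ) (hq : q ≠ 0) (hQ : 0 < Q.natDegree)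
    (f : ℂ → ℂ) (hf : Differentiable ℂ f)
    (htrans : TranscendentalEntire f) (hord : growthOrderEntire f < (1 : EReal))
    (heq : ∀ z : ℂ, f z ^ n + w * f z ^ (n - 1) * deriv f z
        + q.eval z * Complex.exp (Q.eval z) * f (z + c)
      = p₁ * Complex.exp (α₁ * z) + p₂ * Complex.exp (α₂ * z)) :
    Q.natDegree = 1 := by
  have h_growth := HasExpGrowth.of_growthOrderEntire_lt_one hf hord
  have h_nonzero : ∃ a, q.eval a * f (a + c) ≠ 0 := by
    by_contra! h
    have h_q : AnalyticOnNhd ℂ (fun z => q.eval z) Set.univ :=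
      fun z _ => q.differentiable.analyticAt z
    have h_f : AnalyticOnNhd ℂ (fun z => f (z + c)) Set.univ :=
      fun z _ => (hf.comp (differentiable_id.add_const c)).analyticAt z
    have h_qf : ∀ᶠ z in nhdsWithin 0 {0}ᶜ, q.eval z ≠ 0 := by
      by_contra h_freq
      have h_zero := h_q.eqOn_zero_of_preconnected_of_frequently_eq_zero isPreconnected_univ
        (Set.mem_univ 0) ((Filter.not_eventually.1 h_freq).mono fun _ => not_not.1)
      exact hq (Polynomial.funext fun z => by simpa using h_zero (Set.mem_univ z))
    have h_zero := h_f.eqOn_zero_of_preconnected_of_frequently_eq_zero isPreconnected_univ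
      (Set.mem_univ 0) (h_qf.mono fun z hz => (mul_eq_zero.1 (h z)).resolve_left hz).frequently
    exact htrans ⟨0, fun z => by simpa using h_zero (Set.mem_univ (z - c))⟩
  obtain ⟨a, ha⟩ := h_nonzero
  refine le_antisymm (natDegree_le_one_of_mul_cexp_eq (g := fun z => q.eval z * f (z + c))
    (H := fun z => p₁ * Complex.exp (α₁ * z) + p₂ * Complex.exp (α₂ * z) -
      (f z ^ n + w * f z ^ (n - 1) * deriv f z)) ?_ ?_ ?_ ?_ (fun z => ?_) ha) hQ
  · exact q.differentiable.mul (hf.comp (differentiable_id.add_const c))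
  · have h_deriv : Differentiable ℂ (deriv f) := hf.deriv
    fun_prop
  · exact (HasExpGrowth.polynomial q).mul (h_growth.comp_add_const c)
  · exact (((HasExpGrowth.const p₁).mul (.cexp_const_mul α₁)).add
      ((HasExpGrowth.const p₂).mul (.cexp_const_mul α₂))).sub ((h_growth.pow n).add
      (((HasExpGrowth.const w).mul (h_growth.pow (n - 1))).mul (h_growth.deriv hf)))
  · rw [← heq z]
    ring
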